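/- Let F: X ⇉ Y and G: Y ⇉ Z be convex set-valued mappings. Suppose one of the following qualification conditions holds: (i) X = ℝⁿ, Y = ℝᵖ, Z = ℝ^q and ri(rge F) ∩ ri(dom G) ≠ ∅; (ii) X, Y, Z are real locally convex Hausdorff topological vector spaces, int(gph F) ≠ ∅, and int(rge F) ∩ dom G ≠ ∅; (iii) X, Y, Z are Banach spaces, F and G have closed convex graphs, and 0 ∈ sqri(rge F − dom G). Then for every (x̄, z̄) ∈ gph(G∘F), every ȳ with ȳ ∈ F(x̄) and z̄ ∈ G(ȳ), and every z* ∈ Z*, one has D*(G∘F)(x̄, z̄)(z*) = (D*F(x̄, ȳ) ∘ D*G(ȳ, z̄))(z*), i.e., D*(G∘F)(x̄, z̄)(z*) = {x* ∈ X* | ∃ y* ∈ D*G(ȳ, z̄)(z*) with x* ∈ D*F(x̄, ȳ)(y*)}. -/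

import Mathlib

noncomputable section

variable {X Y Z : Type*} [NormedAddCommGroup X] [NormedSpace ℝ X]
  [NormedAddCommGroup Y] [NormedSpace ℝ Y] [NormedAddCommGroup Z] [NormedSpace ℝ Z]

/-- Effective domain of a set-valued mapping. -/
def sdom {U V : Type*} (F : U → Set V) : Set U := {x | (F x).Nonempty}

/-- Range of a set-valued mapping. -/
def srge {U V : Type*} (F : U → Set V) : Set V := {y | ∃ x, y ∈ F x}

/-- Coderivative of a set-valued mapping `H : U ⇉ V` at `(ub, vb) ∈ gph H`. -/
def coderiv {U V : Type*} [NormedAddCommGroup U] [NormedSpace ℝ U]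
    [NormedAddCommGroup V] [NormedSpace ℝ V]
    (H : U → Set V) (ub : U) (vb : V) (vs : V →L[ℝ] ℝ) : Set (U →L[ℝ] ℝ) :=
  {us | ∀ p : U × V, p.2 ∈ H p.1 → us (p.1 - ub) - vs (p.2 - vb) ≤ 0}

/-- The cone generated by a set: `cone A = {t • a | t ≥ 0, a ∈ A}`. -/
def coneGen {W : Type*} [AddCommGroup W] [Module ℝ W] (A : Set W) : Set W :=
  {x | ∃ t : ℝ, 0 ≤ t ∧ ∃ a ∈ A, x = t • a}

/-- `0 ∈ sqri A`: `0 ∈ A` and the cone generated by `A` is a closed linear subspace. -/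
def ZeroSqri {W : Type*} [NormedAddCommGroup W] [NormedSpace ℝ W] (A : Set W) : Prop :=
  (0 : W) ∈ A ∧ ∃ S : Submodule ℝ W, (S : Set W) = coneGen A ∧ IsClosed (S : Set W)

/-- A convex set whose generated cone exhausts the codomain under `L` admits a linear functional on
the codomain lying below `f`, provided `f` is nonnegative on the part of the set killed by `L`. -/
lemma exists_linearMap_le_of_cone {E W : Type*} [AddCommGroup E] [Module ℝ E]
    [AddCommGroup W] [Module ℝ W] (L : W →ₗ[ℝ] E) (f : W →ₗ[ℝ] ℝ) {Q : Set W}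
    (hQ : Convex ℝ Q) (hcone : ∀ e, ∃ t : ℝ, 0 ≤ t ∧ ∃ q ∈ Q, e = t • L q)
    (hf : ∀ q ∈ Q, L q = 0 → 0 ≤ f q) :
    ∃ η : E →ₗ[ℝ] ℝ, ∀ q ∈ Q, η (L q) ≤ f q := by
  obtain ⟨_, _, q₀, hq₀, _⟩ := hcone 0
  let K : PointedCone ℝ (E × ℝ) :=
    { carrier := {p | ∃ t : ℝ, 0 ≤ t ∧ ∃ q ∈ Q, p.1 = t • L q ∧ t * f q ≤ p.2}
      zero_mem' := ⟨0, le_rfl, q₀, hq₀, by simp, by simp⟩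
      add_mem' := by
        rintro ⟨e₁, r₁⟩ ⟨e₂, r₂⟩ ⟨t₁, ht₁, q₁, hq₁, h₁, h₁'⟩ ⟨t₂, ht₂, q₂, hq₂, h₂, h₂'⟩
        simp only at h₁ h₁' h₂ h₂'
        rcases ht₁.eq_or_lt with rfl | ht₁
        · refine ⟨t₂, ht₂, q₂, hq₂, by simp [h₁, h₂], ?_⟩
          simp only [Prod.mk_add_mk]
          linarith
        have hs : 0 < t₁ + t₂ := by linarith
        refine ⟨t₁ + t₂, hs.le, (t₁ / (t₁ + t₂)) • q₁ + (t₂ / (t₁ + t₂)) • q₂,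
          hQ hq₁ hq₂ (by positivity) (by positivity) (by field_simp), ?_, ?_⟩
        · simp only [Prod.mk_add_mk, map_add, map_smul, smul_add, smul_smul, h₁, h₂]
          congr 2 <;> field_simp
        · simp only [Prod.mk_add_mk, map_add, map_smul, smul_eq_mul]
          have : (t₁ + t₂) * (t₁ / (t₁ + t₂) * f q₁ + t₂ / (t₁ + t₂) * f q₂)
              = t₁ * f q₁ + t₂ * f q₂ := by field_simp
          linarith
      smul_mem' := by
        rintro ⟨c, hc⟩ ⟨e, r⟩ ⟨t, ht, q, hq, h, h'⟩
        refine ⟨c * t, mul_nonneg hc ht, q, hq, ?_, ?_⟩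
        · simp only at h
          simp [h, mul_smul, Nonneg.mk_smul]
        · simp only [Nonneg.mk_smul, Prod.smul_mk, smul_eq_mul, mul_assoc]
          exact mul_le_mul_of_nonneg_left h' hc }
  let φ : E × ℝ →ₗ.[ℝ] ℝ :=
    ⟨LinearMap.ker (LinearMap.fst ℝ E ℝ), (LinearMap.snd ℝ E ℝ).comp (Submodule.subtype _)⟩
  obtain ⟨g, hg, hgK⟩ := riesz_extension K φ
    (by
      rintro ⟨⟨e, r⟩, he⟩ ⟨t, ht, q, hq, h, h'⟩
      have he : e = 0 := he
      simp only at h h'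
      change 0 ≤ r
      subst he
      rcases ht.eq_or_lt with rfl | ht
      · linarith
      · have := hf q hq ((smul_eq_zero.1 h.symm).resolve_left ht.ne')
        exact (mul_nonneg ht.le this).trans h')
    (by
      rintro ⟨e, r⟩
      obtain ⟨t, ht, q, hq, h⟩ := hcone e
      exact ⟨⟨(0, t * f q - r), rfl⟩, t, ht, q, hq, by simp [h], by simp⟩)
  refine ⟨-(g.comp (LinearMap.inl ℝ E ℝ)), fun q hq => ?_⟩
  have h1 : 0 ≤ g (L q, f q) := hgK _ ⟨1, zero_le_one, q, hq, by simp, by simp⟩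
  have h2 : g (0, f q) = f q := hg ⟨(0, f q), rfl⟩
  have h3 : g (L q, f q) = g (L q, 0) + g (0, f q) := by rw [← map_add]; simp
  simp only [LinearMap.neg_apply, LinearMap.comp_apply, LinearMap.inl_apply]
  linarith

/-- A linear functional bounded above on a ball around the origin is continuous. -/
lemma LinearMap.continuous_of_le_on_ball {E : Type*} [NormedAddCommGroup E] [NormedSpace ℝ E]
    (η : E →ₗ[ℝ] ℝ) {r C : ℝ} (hr : 0 < r) (h : ∀ e, ‖e‖ < r → η e ≤ C) : Continuous η := by
  refine (η.clmOfExistsBoundedImage ⟨Metric.ball 0 r, Metric.ball_mem_nhds _ hr, ?_⟩).continuous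
  rw [NormedSpace.isVonNBounded_iff]
  refine (Metric.isBounded_Icc (-C) C).subset ?_
  rintro _ ⟨e, he, rfl⟩
  rw [mem_ball_zero_iff] at he
  have h1 := h e he
  have h2 := h (-e) (by simpa using he)
  rw [map_neg] at h2
  exact ⟨by linarith, h1⟩

lemma Convex.sum_geometric_mem {W : Type*} [AddCommGroup W] [Module ℝ W] {Q : Set W}
    (hQ : Convex ℝ Q) (h0 : (0 : W) ∈ Q) (n : ℕ) (q : ℕ → W) (hq : ∀ i, q i ∈ Q) :
    ∑ i ∈ Finset.range n, ((1 / 2 : ℝ) ^ (i + 1)) • q i ∈ Q := by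
  induction n generalizing q with
  | zero => simpa using h0
  | succ n ih =>
    rw [Finset.sum_range_succ']
    have := hQ (ih (fun i => q (i + 1)) fun i => hq _) (hq 0) (a := 1 / 2) (b := 1 / 2)
      (by norm_num) (by norm_num) (by norm_num)
    simpa [Finset.smul_sum, smul_smul, pow_succ'] using this

/-- If the closure of the image of a bounded closed convex set contains a ball, so does the image
itself, with half the radius. -/
lemma exists_mem_of_ball_subset_closure_image {E W : Type*} [NormedAddCommGroup E]
    [NormedSpace ℝ E] [NormedAddCommGroup W] [NormedSpace ℝ W] [CompleteSpace W]
    (L : W →L[ℝ] E) {Q : Set W} (hQ : Convex ℝ Q) (hQc : IsClosed Q) (h0 : (0 : W) ∈ Q)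
    (hQb : Q ⊆ Metric.closedBall 0 1) {r : ℝ} (hr : 0 < r)
    (hball : Metric.ball 0 r ⊆ closure (L '' Q)) {e : E} (he : ‖e‖ < r) :
    ∃ q ∈ Q, e = (2 : ℝ) • L q := by
  have key : ∀ w : Metric.ball (0 : E) r, ∃ q ∈ Q, ‖(2 : ℝ) • (w.1 - L q)‖ < r := by
    rintro ⟨w, hw⟩
    obtain ⟨_, ⟨q, hq, rfl⟩, hd⟩ := Metric.mem_closure_iff.1 (hball hw) (r / 2) (by positivity)
    refine ⟨q, hq, ?_⟩
    rw [norm_smul, ← dist_eq_norm]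
    norm_num
    linarith
  choose c hc hcr using key
  let w : ℕ → Metric.ball (0 : E) r := fun n => Nat.rec ⟨e, by simpa using he⟩
    (fun _ v => ⟨(2 : ℝ) • (v.1 - L (c v)), by simpa using hcr v⟩) n
  have hw : ∀ n, (w (n + 1)).1 = (2 : ℝ) • ((w n).1 - L (c (w n))) := fun n => rfl
  let q : ℕ → W := fun n => c (w n)
  have hq : ∀ n, q n ∈ Q := fun n => hc _
  have hsum : Summable fun i => ((1 / 2 : ℝ) ^ (i + 1)) • q i := by
    refine Summable.of_norm_bounded (g := fun i => (1 / 2 : ℝ) ^ i) summable_geometric_two ?_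
    intro i
    have h1 : ‖q i‖ ≤ 1 := by simpa using hQb (hq i)
    rw [norm_smul, norm_pow, pow_succ]
    have : ‖(1 / 2 : ℝ)‖ = 1 / 2 := by norm_num
    rw [this]
    have hp : (0 : ℝ) < (1 / 2) ^ i := by positivity
    nlinarith [norm_nonneg (q i)]
  have hlim := hsum.hasSum.tendsto_sum_nat
  refine ⟨_, hQc.mem_of_tendsto hlim (Filter.Eventually.of_forall fun n =>
    hQ.sum_geometric_mem h0 n q hq), ?_⟩
  have hpart : ∀ n, (2 : ℝ) • L (∑ i ∈ Finset.range n, ((1 / 2 : ℝ) ^ (i + 1)) • q i)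
      = e - ((1 / 2 : ℝ) ^ n) • (w n).1 := by
    intro n
    induction n with
    | zero => simp [w]
    | succ n ih =>
      rw [Finset.sum_range_succ, map_add, smul_add, ih, hw, map_smul]
      simp only [q]
      rw [smul_smul, smul_smul]
      have : (2 : ℝ) * (1 / 2) ^ (n + 1) = (1 / 2) ^ n := by rw [pow_succ]; ring
      rw [mul_comm _ (2 : ℝ), this, smul_sub]
      abel
  have hz : Filter.Tendsto (fun n => ((1 / 2 : ℝ) ^ n) • (w n).1) Filter.atTop (nhds 0) := by
    refine squeeze_zero_norm (a := fun n => (1 / 2 : ℝ) ^ n * r) (fun n => ?_) ?_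
    · have : ‖(w n).1‖ < r := mem_ball_zero_iff.1 (w n).2
      rw [norm_smul, norm_pow]
      have h2 : ‖(1 / 2 : ℝ)‖ = 1 / 2 := by norm_num
      rw [h2]
      gcongr
    · simpa using (tendsto_pow_atTop_nhds_zero_of_lt_one (r := (1 / 2 : ℝ))
        (by norm_num) (by norm_num)).mul_const r
  have h1 := ((L.continuous.tendsto _).comp hlim).const_smul (2 : ℝ)
  have h2 : Filter.Tendsto (fun n => e - ((1 / 2 : ℝ) ^ n) • (w n).1) Filter.atTop (nhds e) := by
    simpa using hz.const_sub e
  refine tendsto_nhds_unique h2 (h1.congr fun n => ?_)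
  exact hpart n

/-- Baire category argument: if the cone generated by the image of a convex set containing the
origin is a whole Banach space, the closure of the image is a neighbourhood of the origin. -/
lemma closure_mem_nhds_zero_of_cone {E : Type*} [NormedAddCommGroup E] [NormedSpace ℝ E]
    [CompleteSpace E] {D : Set E} (hD : Convex ℝ D) (h0 : (0 : E) ∈ D)
    (hcone : ∀ e, ∃ t : ℝ, 0 ≤ t ∧ ∃ d ∈ D, e = t • d) : closure D ∈ nhds 0 := by
  have hsub : ∀ n : ℕ, IsClosed ((fun e : E => ((n : ℝ) + 1)⁻¹ • e) ⁻¹' closure D) := fun n =>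
    isClosed_closure.preimage (by fun_prop)
  obtain ⟨n, u, hu⟩ := nonempty_interior_of_iUnion_of_closed hsub (by
    refine Set.eq_univ_of_forall fun e => Set.mem_iUnion.2 ?_
    obtain ⟨t, ht, d, hd, rfl⟩ := hcone e
    obtain ⟨n, hn⟩ := exists_nat_ge t
    refine ⟨n, subset_closure ?_⟩
    simp only [smul_smul]
    refine hD.smul_mem_of_zero_mem h0 hd ⟨by positivity, ?_⟩
    rw [inv_mul_le_one₀ (by positivity)]
    linarith)
  have hn : ((n : ℝ) + 1)⁻¹ ≠ 0 := by positivity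
  have hv : ((n : ℝ) + 1)⁻¹ • u ∈ interior (closure D) := by
    have := (Homeomorph.smulOfNeZero _ hn (α := E)).preimage_interior (closure D)
    have hu' : u ∈ (Homeomorph.smulOfNeZero _ hn (α := E)) ⁻¹' interior (closure D) := by
      rw [this]; exact hu
    exact hu'
  obtain ⟨t, ht, d, hd, h⟩ := hcone (-(((n : ℝ) + 1)⁻¹ • u))
  rw [← mem_interior_iff_mem_nhds]
  have := hD.closure.combo_interior_self_mem_interior hv (subset_closure hd)
    (a := 1 / (1 + t)) (b := t / (1 + t)) (by positivity) (by positivity) (by field_simp)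
  convert this
  rw [div_eq_inv_mul t, mul_smul, ← h]
  simp

/-- A linear functional on a Banach space is continuous if it is dominated by a continuous
functional along the image of a closed convex set whose generated cone is the whole space. -/
lemma LinearMap.continuous_of_le_on_closed_convex {E W : Type*} [NormedAddCommGroup E]
    [NormedSpace ℝ E] [CompleteSpace E] [NormedAddCommGroup W] [NormedSpace ℝ W] [CompleteSpace W]
    (L : W →L[ℝ] E) (f : W →L[ℝ] ℝ) {Q : Set W} (hQ : Convex ℝ Q) (hQc : IsClosed Q)
    (h0 : (0 : W) ∈ Q) (hcone : ∀ e, ∃ t : ℝ, 0 ≤ t ∧ ∃ q ∈ Q, e = t • L q)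
    (η : E →ₗ[ℝ] ℝ) (hη : ∀ q ∈ Q, η (L q) ≤ f q) : Continuous η := by
  have hR : Convex ℝ (Q ∩ Metric.closedBall 0 1) := hQ.inter (convex_closedBall _ _)
  have hR0 : (0 : W) ∈ Q ∩ Metric.closedBall 0 1 := ⟨h0, by simp⟩
  obtain ⟨r, hr, hball⟩ := Metric.mem_nhds_iff.1 (closure_mem_nhds_zero_of_cone
    (D := L '' (Q ∩ Metric.closedBall 0 1)) (hR.linear_image L.toLinearMap) ⟨0, hR0, by simp⟩
    (by
      intro e
      obtain ⟨t, ht, q, hq, rfl⟩ := hcone e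
      have hp : 0 < 1 + ‖q‖ := by positivity
      refine ⟨t * (1 + ‖q‖), by positivity, _, ⟨(1 + ‖q‖)⁻¹ • q, ⟨?_, ?_⟩, rfl⟩, ?_⟩
      · refine hQ.smul_mem_of_zero_mem h0 hq ⟨by positivity, ?_⟩
        exact inv_le_one_of_one_le₀ (by linarith [norm_nonneg q])
      · rw [mem_closedBall_zero_iff, norm_smul, norm_inv, Real.norm_of_nonneg hp.le,
          inv_mul_le_one₀ hp]
        linarith
      · rw [map_smul, smul_smul, mul_assoc, mul_inv_cancel₀ hp.ne', mul_one]))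
  refine η.continuous_of_le_on_ball hr (C := 2 * ‖f‖) fun e he => ?_
  obtain ⟨q, ⟨hq, hq1⟩, rfl⟩ := exists_mem_of_ball_subset_closure_image L hR
    (hQc.inter Metric.isClosed_closedBall) hR0 Set.inter_subset_right hr hball he
  have h1 := hη q hq
  have h2 := (Real.le_norm_self _).trans (f.le_opNorm q)
  have h3 : ‖q‖ ≤ 1 := by simpa using hq1
  rw [map_smul, smul_eq_mul]
  nlinarith [norm_nonneg f]

/-- The cone generated by a convex set is a subspace as soon as the set contains a negative
multiple of each of its elements. -/
lemma exists_submodule_eq_coneGen {E : Type*} [AddCommGroup E] [Module ℝ E] {D : Set E}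
    (hD : Convex ℝ D) (h0 : (0 : E) ∈ D) (hneg : ∀ d ∈ D, ∃ ε : ℝ, 0 < ε ∧ -(ε • d) ∈ D) :
    ∃ S : Submodule ℝ E, (S : Set E) = coneGen D := by
  have hpos : ∀ c : ℝ, 0 ≤ c → ∀ x ∈ coneGen D, c • x ∈ coneGen D := by
    rintro c hc _ ⟨t, ht, d, hd, rfl⟩
    exact ⟨c * t, by positivity, d, hd, smul_smul _ _ _⟩
  refine ⟨{ carrier := coneGen D, zero_mem' := ⟨0, le_rfl, 0, h0, by simp⟩,
            add_mem' := ?_, smul_mem' := ?_ }, rfl⟩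
  · rintro _ _ ⟨t₁, ht₁, d₁, hd₁, rfl⟩ ⟨t₂, ht₂, d₂, hd₂, rfl⟩
    rcases ht₁.eq_or_lt with rfl | ht₁
    · exact ⟨t₂, ht₂, d₂, hd₂, by simp⟩
    have hs : 0 < t₁ + t₂ := by linarith
    refine ⟨t₁ + t₂, hs.le, (t₁ / (t₁ + t₂)) • d₁ + (t₂ / (t₁ + t₂)) • d₂,
      hD hd₁ hd₂ (by positivity) (by positivity) (by field_simp), ?_⟩
    simp only [smul_add, smul_smul]
    congr 2 <;> field_simp
  · intro c x hx
    rcases le_total 0 c with hc | hc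
    · exact hpos c hc x hx
    · obtain ⟨t, ht, d, hd, rfl⟩ := hx
      obtain ⟨ε, hε, h⟩ := hneg d hd
      refine ⟨-c * t / ε, div_nonneg (mul_nonneg (by linarith) ht) hε.le, _, h, ?_⟩
      rw [← neg_smul, smul_smul, smul_smul]
      congr 1
      field_simp

/-- From a point of the intrinsic interior, one can move slightly away from any point of the set
without leaving it. -/
lemma eventually_sub_smul_mem_of_mem_intrinsicInterior {E : Type*} [NormedAddCommGroup E]
    [NormedSpace ℝ E] {A : Set E} {y a : E} (hy : y ∈ intrinsicInterior ℝ A) (ha : a ∈ A) :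
    ∀ᶠ ε : ℝ in nhds 0, y - ε • (a - y) ∈ A := by
  obtain ⟨y, hyi, rfl⟩ := mem_intrinsicInterior.1 hy
  have hmem : ∀ ε : ℝ, AffineMap.lineMap (y : E) a (-ε) ∈ affineSpan ℝ A := fun ε =>
    AffineMap.lineMap_mem _ y.2 (subset_affineSpan ℝ A ha)
  have hcont : Continuous fun ε : ℝ => (⟨_, hmem ε⟩ : affineSpan ℝ A) :=
    Continuous.subtype_mk (by fun_prop) _
  have h0 : (⟨_, hmem 0⟩ : affineSpan ℝ A) = y := by ext; simp
  have := hcont.tendsto 0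
  rw [h0] at this
  filter_upwards [this (mem_interior_iff_mem_nhds.1 hyi)] with ε hε
  have hε' : AffineMap.lineMap (y : E) a (-ε) ∈ A := hε
  rw [AffineMap.lineMap_apply_module'] at hε'
  convert hε' using 1
  rw [neg_smul]
  abel

/-- An interior point of the range of a convex set-valued mapping, whose graph has nonempty
interior, is the second coordinate of an interior point of the graph. -/
lemma exists_mem_interior_graph {X Y : Type*} [NormedAddCommGroup X] [NormedSpace ℝ X]
    [NormedAddCommGroup Y] [NormedSpace ℝ Y] {F : X → Set Y}
    (hF : Convex ℝ {p : X × Y | p.2 ∈ F p.1})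
    (hne : (interior {p : X × Y | p.2 ∈ F p.1}).Nonempty) {y : Y} (hy : y ∈ interior (srge F)) :
    ∃ x, (x, y) ∈ interior {p : X × Y | p.2 ∈ F p.1} := by
  obtain ⟨⟨x₁, y₁⟩, h₁⟩ := hne
  have hcont : Filter.Tendsto (fun ε : ℝ => y + ε • (y - y₁)) (nhdsWithin 0 (Set.Ioi 0))
      (nhds y) := by
    have : Continuous fun ε : ℝ => y + ε • (y - y₁) := by fun_prop
    simpa using (this.tendsto 0).mono_left nhdsWithin_le_nhds
  obtain ⟨ε, ⟨x₂, hx₂⟩, hε⟩ := ((hcont.eventually (mem_interior_iff_mem_nhds.1 hy)).and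
    self_mem_nhdsWithin).exists
  have hε : 0 < ε := hε
  have := hF.combo_interior_self_mem_interior h₁ (y := (x₂, y + ε • (y - y₁))) hx₂
    (a := ε / (1 + ε)) (b := 1 / (1 + ε)) (by positivity) (by positivity) (by field_simp; ring)
  refine ⟨(ε / (1 + ε)) • x₁ + (1 / (1 + ε)) • x₂, ?_⟩
  convert this using 1
  simp only [Prod.smul_mk, Prod.mk_add_mk, Prod.mk.injEq, true_and]
  have h1 : (1 + ε) ≠ 0 := by positivity
  have h2 : (1 / (1 + ε) + ε / (1 + ε)) = 1 := by field_simp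
  calc y = (1 / (1 + ε) + ε / (1 + ε)) • y := by rw [h2, one_smul]
    _ = _ := by
      rw [smul_add, smul_smul, smul_sub, add_smul,
        show 1 / (1 + ε) * ε = ε / (1 + ε) by field_simp]
      abel

/-- Displacements `(s, x, y, z)` from `(xb, yb, zb)` with `(xb + x, yb + y + s)` in the graph of `F`
and `(yb + y, zb + z)` in the graph of `G`. -/
def displacementSet (F : X → Set Y) (G : Y → Set Z) (xb : X) (yb : Y) (zb : Z)
    (S : Submodule ℝ Y) : Set (S × X × Y × Z) :=
  {q | yb + q.2.2.1 + q.1 ∈ F (xb + q.2.1) ∧ zb + q.2.2.2 ∈ G (yb + q.2.2.1)}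

section displacementSet

variable {F : X → Set Y} {G : Y → Set Z} {xb : X} {yb : Y} {zb : Z} {S : Submodule ℝ Y}

lemma zero_mem_displacementSet {U V W : Type*} [NormedAddCommGroup U] [NormedAddCommGroup V]
    [NormedSpace ℝ V] [NormedAddCommGroup W] {F : U → Set V} {G : V → Set W} {xb : U} {yb : V} {zb : W}
    {S : Submodule ℝ V}
    (hF : yb ∈ F xb) (hG : zb ∈ G yb) :
    0 ∈ displacementSet F G xb yb zb S := by
  simp [displacementSet, hF, hG]

lemma convex_displacementSet (hcF : Convex ℝ {p : X × Y | p.2 ∈ F p.1})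
    (hcG : Convex ℝ {p : Y × Z | p.2 ∈ G p.1}) :
    Convex ℝ (displacementSet F G xb yb zb S) := by
  rintro ⟨s₁, x₁, y₁, z₁⟩ ⟨hF₁, hG₁⟩ ⟨s₂, x₂, y₂, z₂⟩ ⟨hF₂, hG₂⟩ a b ha hb hab
  have hFc := hcF (x := (_, _)) hF₁ (y := (_, _)) hF₂ ha hb hab
  have hGc := hcG (x := (_, _)) hG₁ (y := (_, _)) hG₂ ha hb hab
  obtain rfl : b = 1 - a := by linarith
  constructor
  · refine (congrArg₂ (fun (u : X) v => v ∈ F u) ?_ ?_).mpr hFc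
    · simp only [Prod.smul_mk, Prod.mk_add_mk]
      module
    · simp only [Prod.smul_mk, Prod.mk_add_mk, Submodule.coe_add, Submodule.coe_smul]
      module
  · refine (congrArg₂ (fun (u : Y) v => v ∈ G u) ?_ ?_).mpr hGc
    all_goals
      simp only [Prod.smul_mk, Prod.mk_add_mk]
      module

lemma isClosed_displacementSet {U V W : Type*} [NormedAddCommGroup U] [NormedAddCommGroup V]
    [NormedSpace ℝ V] [NormedAddCommGroup W] {F : U → Set V} {G : V → Set W} {xb : U} {yb : V} {zb : W}
    {S : Submodule ℝ V}
    (hF : IsClosed {p : U × V | p.2 ∈ F p.1})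
    (hG : IsClosed {p : V × W | p.2 ∈ G p.1}) :
    IsClosed (displacementSet F G xb yb zb S) :=
  (hF.preimage (f := fun q : S × U × V × W => (xb + q.2.1, yb + q.2.2.1 + (q.1 : V)))
    (by fun_prop)).inter
  (hG.preimage (f := fun q : S × U × V × W => (yb + q.2.2.1, zb + q.2.2.2)) (by fun_prop))

open Pointwise in
lemma exists_mem_displacementSet_eq_smul {U V W : Type*} [NormedAddCommGroup U] [NormedAddCommGroup V]
    [NormedSpace ℝ V] [NormedAddCommGroup W] {F : U → Set V} {G : V → Set W} {xb : U} {yb : V} {zb : W}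
    {S : Submodule ℝ V}
    (hS : (S : Set V) = coneGen (srge F - sdom G)) (s : S) :
    ∃ t : ℝ, 0 ≤ t ∧ ∃ q ∈ displacementSet F G xb yb zb S, s = t • q.1 := by
  obtain ⟨s, hs⟩ := s
  have hs' : s ∈ coneGen (srge F - sdom G) := hS ▸ hs
  obtain ⟨t, ht, _, ⟨y₁, ⟨x, hx⟩, y₂, ⟨z, hz⟩, rfl⟩, rfl⟩ := hs'
  have hmem : y₁ - y₂ ∈ (S : Set V) :=
    hS ▸ ⟨1, zero_le_one, _, ⟨y₁, ⟨x, hx⟩, y₂, ⟨z, hz⟩, rfl⟩, (one_smul _ _).symm⟩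
  refine ⟨t, ht, (⟨y₁ - y₂, hmem⟩, x - xb, y₂ - yb, z - zb), ?_, rfl⟩
  simpa [displacementSet] using ⟨hx, hz⟩

open Pointwise in
lemma exists_mem_coderiv_of_continuous (hcF : Convex ℝ {p : X × Y | p.2 ∈ F p.1})
    (hcG : Convex ℝ {p : Y × Z | p.2 ∈ G p.1}) (hF : yb ∈ F xb) (hG : zb ∈ G yb)
    (hS : (S : Set Y) = coneGen (srge F - sdom G)) {zs : Z →L[ℝ] ℝ} {xs : X →L[ℝ] ℝ}
    (hxs : xs ∈ coderiv (fun x => {z | ∃ y ∈ F x, z ∈ G y}) xb zb zs)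
    (hcont : ∀ η : S →ₗ[ℝ] ℝ,
      (∀ q ∈ displacementSet F G xb yb zb S, η q.1 ≤ zs q.2.2.2 - xs q.2.1) → Continuous η) :
    ∃ ys ∈ coderiv G yb zb zs, xs ∈ coderiv F xb yb ys := by
  obtain ⟨η, hη⟩ := exists_linearMap_le_of_cone (LinearMap.fst ℝ S (X × Y × Z))
    ((zs.toLinearMap.comp (LinearMap.snd ℝ Y Z)).comp
      ((LinearMap.snd ℝ X (Y × Z)).comp (LinearMap.snd ℝ S (X × Y × Z))) -
      xs.toLinearMap.comp ((LinearMap.fst ℝ X (Y × Z)).comp (LinearMap.snd ℝ S (X × Y × Z))))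
    (convex_displacementSet (F := F) (G := G) (xb := xb) (yb := yb) (zb := zb) hcF hcG)
    (exists_mem_displacementSet_eq_smul hS) (by
      rintro ⟨s, x, y, z⟩ ⟨h₁, h₂⟩ hs
      have hs : s = 0 := hs
      subst hs
      have := hxs (xb + x, zb + z) ⟨yb + y, by simpa using h₁, h₂⟩
      simpa using this)
  replace hη : ∀ q ∈ displacementSet F G xb yb zb S, η q.1 ≤ zs q.2.2.2 - xs q.2.1 := hη
  obtain ⟨g, hg, -⟩ := exists_extension_norm_eq S ⟨η, hcont η hη⟩
  replace hg : ∀ s : S, g s = η s := hg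
  have hmem : ∀ y₁ ∈ srge F, ∀ y₂ ∈ sdom G, y₁ - y₂ ∈ S := fun y₁ h₁ y₂ h₂ => by
    have : y₁ - y₂ ∈ (S : Set Y) :=
      hS ▸ ⟨1, zero_le_one, _, Set.sub_mem_sub h₁ h₂, (one_smul _ _).symm⟩
    exact this
  refine ⟨-g, ?_, ?_⟩
  · rintro ⟨y, z⟩ hz
    have := hη (⟨yb - y, hmem _ ⟨xb, hF⟩ _ ⟨z, hz⟩⟩, 0, y - yb, z - zb)
      (by simpa [displacementSet] using ⟨hF, hz⟩)
    rw [← hg] at this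
    simp only [map_zero, map_sub, neg_apply] at this ⊢
    linarith
  · rintro ⟨x, y⟩ hy
    have := hη (⟨y - yb, hmem _ ⟨x, hy⟩ _ ⟨zb, hG⟩⟩, x - xb, 0, 0)
      (by simpa [displacementSet] using ⟨hy, hG⟩)
    rw [← hg] at this
    simp only [map_zero, map_sub, neg_apply] at this ⊢
    linarith

end displacementSet

open Pointwise in
lemma exists_submodule_eq_coneGen_srge_sub_sdom {F : X → Set Y} {G : Y → Set Z}
    (hcF : Convex ℝ {p : X × Y | p.2 ∈ F p.1}) (hcG : Convex ℝ {p : Y × Z | p.2 ∈ G p.1})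
    {yb : Y} (hF : yb ∈ srge F) (hG : yb ∈ sdom G)
    (hneg : ∀ y₁ ∈ srge F, ∀ y₂ ∈ sdom G, ∃ ε : ℝ, 0 < ε ∧ -(ε • (y₁ - y₂)) ∈ srge F - sdom G) :
    ∃ S : Submodule ℝ Y, (S : Set Y) = coneGen (srge F - sdom G) := by
  have h₁ : srge F = LinearMap.snd ℝ X Y '' {p : X × Y | p.2 ∈ F p.1} := by
    ext y; simp [srge]
  have h₂ : sdom G = LinearMap.fst ℝ Y Z '' {p : Y × Z | p.2 ∈ G p.1} := by
    ext y; simp [sdom, Set.Nonempty]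
  have hD : Convex ℝ (srge F - sdom G) := by
    rw [h₁, h₂]
    exact (hcF.linear_image _).sub (hcG.linear_image _)
  refine exists_submodule_eq_coneGen hD ⟨yb, hF, yb, hG, sub_self _⟩ ?_
  rintro _ ⟨y₁, hy₁, y₂, hy₂, rfl⟩
  exact hneg y₁ hy₁ y₂ hy₂

open Pointwise in
/-- Coderivative chain rule for convex set-valued mappings: under a qualification
condition, `D*(G∘F)(xb, zb)(z*) = D*F(xb, yb) ∘ D*G(yb, zb)(z*)` whenever
`yb ∈ F(xb)` and `zb ∈ G(yb)`. -/
theorem coderiv_chain_rule (F : X → Set Y) (G : Y → Set Z)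
    (hcF : Convex ℝ {p : X × Y | p.2 ∈ F p.1})
    (hcG : Convex ℝ {p : Y × Z | p.2 ∈ G p.1})
    (hqc : (FiniteDimensional ℝ X ∧ FiniteDimensional ℝ Y ∧ FiniteDimensional ℝ Z ∧
        (intrinsicInterior ℝ (srge F) ∩ intrinsicInterior ℝ (sdom G)).Nonempty) ∨
      ((interior {p : X × Y | p.2 ∈ F p.1}).Nonempty ∧
        (interior (srge F) ∩ sdom G).Nonempty) ∨
      (CompleteSpace X ∧ CompleteSpace Y ∧ CompleteSpace Z ∧
        IsClosed {p : X × Y | p.2 ∈ F p.1} ∧ IsClosed {p : Y × Z | p.2 ∈ G p.1} ∧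
        ZeroSqri (srge F - sdom G)))
    (xb : X) (yb : Y) (zb : Z) (hF : yb ∈ F xb) (hG : zb ∈ G yb) (zs : Z →L[ℝ] ℝ) :
    coderiv (fun x => {z | ∃ y ∈ F x, z ∈ G y}) xb zb zs =
      {xs : X →L[ℝ] ℝ | ∃ ys ∈ coderiv G yb zb zs, xs ∈ coderiv F xb yb ys} := by
  ext xs
  constructor
  · intro hxs
    rcases hqc with ⟨-, _, -, y₀, hy₁, hy₂⟩ | ⟨hne, y₀, hy₀, z₀, hz₀⟩ |
      ⟨_, _, _, hclF, hclG, -, S, hS, hSc⟩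
    · obtain ⟨S, hS⟩ := exists_submodule_eq_coneGen_srge_sub_sdom hcF hcG ⟨xb, hF⟩ ⟨zb, hG⟩
        (fun a ha b hb => by
          obtain ⟨ε, ⟨h₁, h₂⟩, hε⟩ :=
            ((((eventually_sub_smul_mem_of_mem_intrinsicInterior hy₁ ha).and
              (eventually_sub_smul_mem_of_mem_intrinsicInterior hy₂ hb)).filter_mono
              nhdsWithin_le_nhds).and (self_mem_nhdsWithin (s := Set.Ioi (0 : ℝ)))).exists
          refine ⟨ε, hε, _, h₁, _, h₂, ?_⟩
          simp only
          module)
      exact exists_mem_coderiv_of_continuous hcF hcG hF hG hS hxs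
        fun η _ => η.continuous_of_finiteDimensional
    · obtain ⟨S, hS⟩ := exists_submodule_eq_coneGen_srge_sub_sdom hcF hcG ⟨xb, hF⟩ ⟨zb, hG⟩
        (fun a _ b _ => by
          have hc : Continuous fun ε : ℝ => y₀ - ε • (a - b) := by fun_prop
          have ht := hc.tendsto 0
          rw [zero_smul, sub_zero] at ht
          obtain ⟨ε, h, hε⟩ := (((ht.eventually (mem_interior_iff_mem_nhds.1 hy₀)).filter_mono
            nhdsWithin_le_nhds).and (self_mem_nhdsWithin (s := Set.Ioi (0 : ℝ)))).exists
          exact ⟨ε, hε, _, h, y₀, ⟨z₀, hz₀⟩, by simp⟩)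
      refine exists_mem_coderiv_of_continuous hcF hcG hF hG hS hxs fun η hη => ?_
      obtain ⟨x₀, hx₀⟩ := exists_mem_interior_graph hcF hne hy₀
      have hc : Continuous fun s : S => (x₀, y₀ + (s : Y)) := by fun_prop
      have ht := hc.tendsto 0
      rw [ZeroMemClass.coe_zero, add_zero] at ht
      obtain ⟨r, hr, hball⟩ := Metric.mem_nhds_iff.1 (ht (mem_interior_iff_mem_nhds.1 hx₀))
      refine η.continuous_of_le_on_ball hr (C := zs (z₀ - zb) - xs (x₀ - xb)) fun s hs => ?_
      have hs' : y₀ + (s : Y) ∈ F x₀ := hball (mem_ball_zero_iff.2 hs)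
      exact hη (s, x₀ - xb, y₀ - yb, z₀ - zb) (by simpa [displacementSet] using ⟨hs', hz₀⟩)
    · have : CompleteSpace S := hSc.completeSpace_coe
      refine exists_mem_coderiv_of_continuous hcF hcG hF hG hS hxs fun η hη => ?_
      exact η.continuous_of_le_on_closed_convex (ContinuousLinearMap.fst ℝ S (X × Y × Z))
        ((zs.comp (ContinuousLinearMap.snd ℝ Y Z)).comp
          ((ContinuousLinearMap.snd ℝ X (Y × Z)).comp
            (ContinuousLinearMap.snd ℝ S (X × Y × Z))) -
          xs.comp ((ContinuousLinearMap.fst ℝ X (Y × Z)).comp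
            (ContinuousLinearMap.snd ℝ S (X × Y × Z))))
        (convex_displacementSet hcF hcG) (isClosed_displacementSet hclF hclG)
        (zero_mem_displacementSet hF hG) (exists_mem_displacementSet_eq_smul hS) hη
  · rintro ⟨ys, hys, hxs⟩ ⟨x, z⟩ ⟨y, hy, hz⟩
    have h₁ := hxs (x, y) hy
    have h₂ := hys (y, z) hz
    simp only at h₁ h₂ ⊢
    linarith

end
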